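/- Let T be a symmetric monoidal triangulated category with all small coproducts whose tensor product is exact and commutes with coproducts in each variable, and let (T_i)_{i∈I} be a set-indexed family of such categories, each compactly generated by a set of compact objects. Suppose for each i there is an exact, coproduct-preserving, strong symmetric monoidal functor F_i : T → T_i admitting an exact left adjoint L_i, satisfying the projection formula (for every X in T and Y in T_i there is an isomorphism L_i(F_iX ⊗ Y) ≅ X ⊗ L_iY) and the retract property (every object Y of T_i is a retract of F_iL_iY), and suppose the detection property holds: X ≅ 0 in T if and only if F_iX ≅ 0 for all i ∈ I. Then for every object X of T one has Loc⊗({X}) = Loc⊗({⊕_{i∈I} L_iF_iX}); equivalently, for every localising tensor ideal L of T and every object X of T, X ∈ L if and only if L_iF_iX ∈ L for all i ∈ I. -/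

import Mathlib

open CategoryTheory CategoryTheory.Limits CategoryTheory.Pretriangulated

universe v u u₂

section Defs

variable (C : Type u) [Category.{v} C] [Preadditive C] [HasCoproducts.{v} C]

/-- The canonical map `⨁ᵢ Hom(X, Yᵢ) → Hom(X, ∐ Y)`. -/
noncomputable def coproductComparison (X : C) {ι : Type v} (Y : ι → C) :
    DirectSum ι (fun i => X ⟶ Y i) →+ (X ⟶ ∐ Y) := by
  classical
  exact DirectSum.toAddMonoid fun i =>
    AddMonoidHom.mk' (fun g => g ≫ Sigma.ι Y i)
      (fun a b => Preadditive.add_comp _ _ _ a b (Sigma.ι Y i))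

variable {C} in
/-- An object `X` is compact if `Hom(X, -)` commutes with small coproducts, i.e. the
canonical map `⨁ᵢ Hom(X, Yᵢ) → Hom(X, ∐ Y)` is bijective for every small family `Y`. -/
def IsCompactObject (X : C) : Prop :=
  ∀ ⦃ι : Type v⦄ (Y : ι → C), Function.Bijective (coproductComparison C X Y)

variable [HasZeroObject C] [HasShift C ℤ] [∀ n : ℤ, (shiftFunctor C n).Additive]
  [Pretriangulated C]

/-- A localising subcategory: a full triangulated subcategory closed under direct
summands and small coproducts. -/
def IsLocalisingSubcategory (L : Set C) : Prop :=
  (∀ ⦃X Y : C⦄, (X ≅ Y) → X ∈ L → Y ∈ L) ∧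
  (∀ X : C, IsZero X → X ∈ L) ∧
  (∀ ⦃X : C⦄ (n : ℤ), X ∈ L → (X⟦n⟧ : C) ∈ L) ∧
  (∀ T : Triangle C, T ∈ (distTriang C) → T.obj₁ ∈ L → T.obj₂ ∈ L → T.obj₃ ∈ L) ∧
  (∀ ⦃X Y : C⦄ (i : X ⟶ Y) (r : Y ⟶ X), i ≫ r = 𝟙 X → Y ∈ L → X ∈ L) ∧
  (∀ ⦃ι : Type v⦄ (f : ι → C), (∀ j, f j ∈ L) → (∐ f) ∈ L)

/-- A triangulated category with coproducts is compactly generated by a set `S` of compact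
objects if every member of `S` is compact and the only localising subcategory containing
`S` is the whole category. -/
def IsCompactlyGeneratedBy (S : Set C) : Prop :=
  (∀ X ∈ S, IsCompactObject X) ∧
  (∀ L : Set C, IsLocalisingSubcategory C L → S ⊆ L → ∀ X : C, X ∈ L)

end Defs

open MonoidalCategory

section TensorTriangulated

variable (C : Type u) [Category.{v} C] [Preadditive C] [HasCoproducts.{v} C]
  [HasZeroObject C] [HasShift C ℤ] [∀ n : ℤ, (shiftFunctor C n).Additive]
  [Pretriangulated C] [MonoidalCategory C]

/-- A localising tensor ideal of a tensor-triangulated category: a localising subcategory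
closed under tensoring with arbitrary objects. -/
def IsLocalisingTensorIdeal (L : Set C) : Prop :=
  IsLocalisingSubcategory C L ∧ (∀ ⦃X : C⦄, X ∈ L → ∀ Y : C, (X ⊗ Y) ∈ L)

/-- `Loc⊗(S)`: the smallest localising tensor ideal containing `S`. -/
def locTensorIdealGen (S : Set C) : Set C :=
  ⋂₀ {L : Set C | IsLocalisingTensorIdeal C L ∧ S ⊆ L}

end TensorTriangulated

/-- A localising subcategory contains the first term of a distinguished triangle whose other
two terms it contains. -/
lemma IsLocalisingSubcategory.mem_obj₁ {C : Type u} [Category.{v} C] [Preadditive C]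
    [HasCoproducts.{v} C] [HasZeroObject C] [HasShift C ℤ]
    [∀ n : ℤ, (shiftFunctor C n).Additive] [Pretriangulated C] {L : Set C}
    (hL : IsLocalisingSubcategory C L) (T : Triangle C) (hT : T ∈ distTriang C)
    (h₂ : T.obj₂ ∈ L) (h₃ : T.obj₃ ∈ L) : T.obj₁ ∈ L := by
  obtain ⟨hiso, -, hshift, hcone, -⟩ := hL
  have h : (T.obj₁⟦(1 : ℤ)⟧ : C) ∈ L := hcone _ (rot_of_distTriang _ hT) h₂ h₃
  exact hiso ((shiftEquiv C (1 : ℤ)).unitIso.symm.app T.obj₁) (hshift (-1) h)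

/-- A sequence `A 0 ⟶ A 1 ⟶ ⋯` over `X` such that `A 0 ⟶ X` is a split epimorphism and every
`A n ⟶ A (n + 1)` kills whatever `A n ⟶ X` kills has homotopy colimit `X`. -/
lemma isIso_of_telescope {C : Type*} [Category* C] [Preadditive C] [HasZeroObject C]
    [HasShift C ℤ] [∀ n : ℤ, (shiftFunctor C n).Additive] [Pretriangulated C]
    {A : ℕ → C} {X P H : C} (a : ∀ n, A n ⟶ A (n + 1)) (p : ∀ n, A n ⟶ X)
    (hap : ∀ n, a n ≫ p (n + 1) = p n)
    (hker : ∀ n ⦃Y : C⦄ (f : Y ⟶ A n), f ≫ p n = 0 → f ≫ a n = 0)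
    (σ₀ : X ⟶ A 0) (hσ₀ : σ₀ ≫ p 0 = 𝟙 X)
    (ι : ∀ n, A n ⟶ P) (hP : IsColimit (Cofan.mk P ι))
    (s : P ⟶ P) (hs : ∀ n, ι n ≫ s = a n ≫ ι (n + 1))
    (q : P ⟶ H) (δ : H ⟶ P⟦(1 : ℤ)⟧)
    (hT : Triangle.mk (𝟙 P - s) q δ ∈ distTriang C)
    (ψ : H ⟶ X) (hψ : ∀ n, ι n ≫ q ≫ ψ = p n) : IsIso ψ := by
  have hext {Z : C} (f g : P ⟶ Z) (h : ∀ n, ι n ≫ f = ι n ≫ g) : f = g :=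
    Cofan.IsColimit.hom_ext hP _ _ h
  let σ : ∀ n, X ⟶ A n := fun n => Nat.rec σ₀ (fun n x => x ≫ a n) n
  have hσa (n : ℕ) : σ n ≫ a n = σ (n + 1) := rfl
  have hσ (n : ℕ) : σ n ≫ p n = 𝟙 X := by
    induction n with
    | zero => exact hσ₀
    | succ n ih => rw [← hσa, Category.assoc, hap, ih]
  have ha (n : ℕ) : p n ≫ σ (n + 1) = a n := by
    have h := hker n (𝟙 _ - p n ≫ σ n) (by simp [Preadditive.sub_comp, hσ])
    rw [Preadditive.sub_comp, sub_eq_zero, Category.id_comp, Category.assoc, hσa] at h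
    exact h.symm
  let u : ∀ n, X ⟶ P := fun n => Nat.rec 0 (fun n x => x + σ n ≫ ι n) n
  have hu (n : ℕ) : u (n + 1) = u n + σ n ≫ ι n := rfl
  let t : P ⟶ P := Cofan.IsColimit.desc hP
    (fun n => ι n - p n ≫ σ n ≫ ι n - p n ≫ u n)
  have ht (n : ℕ) : ι n ≫ t = ι n - p n ≫ σ n ≫ ι n - p n ≫ u n :=
    Cofan.IsColimit.fac hP _ n
  have hst : (𝟙 P - s) ≫ t = 𝟙 P := by
    refine hext _ _ fun n => ?_
    rw [Preadditive.sub_comp, Preadditive.comp_sub, Category.id_comp, reassoc_of% (hs n), ht, ht,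
      Category.comp_id, hu]
    simp only [Preadditive.comp_sub, Preadditive.comp_add, reassoc_of% (hap n),
      reassoc_of% (ha n)]
    abel
  have hmono : Mono (𝟙 P - s) := mono_of_mono_fac hst
  have hδ : δ = 0 := Triangle.mor₃_eq_zero_of_mono₁ _ hT hmono
  have hq : Epi q := Triangle.epi₂ _ hT hδ
  have hsq : s ≫ q = q := by
    have h : (𝟙 P - s) ≫ q = 0 := comp_distTriang_mor_zero₁₂ _ hT
    rw [Preadditive.sub_comp, sub_eq_zero, Category.id_comp] at h
    exact h.symm
  have hιq (n : ℕ) : a n ≫ ι (n + 1) ≫ q = ι n ≫ q := by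
    rw [← Category.assoc, ← hs, Category.assoc, hsq]
  have hσq (n : ℕ) : σ n ≫ ι n ≫ q = σ₀ ≫ ι 0 ≫ q := by
    induction n with
    | zero => rfl
    | succ n ih => rw [← ih, ← hσa, Category.assoc, hιq]
  refine ⟨σ₀ ≫ ι 0 ≫ q, ?_, ?_⟩
  · rw [← cancel_epi q]
    refine hext _ _ fun n => ?_
    rw [Category.comp_id, reassoc_of% (hψ n), ← hσq (n + 1), reassoc_of% (ha n), hιq]
  · rw [Category.assoc, Category.assoc, hψ, hσ₀]

section Detection

variable {T : Type u} [Category.{v} T] [HasCoproducts.{v} T]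
  {I : Type v} {D : I → Type u₂} [∀ i, Category.{v} (D i)]

/-- The counits of a family of adjunctions assemble to a map from a coproduct which every right
adjoint turns into a split epimorphism. -/
lemma exists_section_map_desc_counit {G : ∀ i, D i ⥤ T} {F : ∀ i, T ⥤ D i}
    (adj : ∀ i, G i ⊣ F i) (X : T) (i : I) :
    ∃ σ : (F i).obj X ⟶ (F i).obj (∐ fun j => (G j).obj ((F j).obj X)),
      σ ≫ (F i).map (Sigma.desc fun j => (adj j).counit.app X) = 𝟙 _ :=
  ⟨(adj i).unit.app _ ≫ (F i).map (Sigma.ι (fun j => (G j).obj ((F j).obj X)) i), by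
    rw [Category.assoc, ← Functor.map_comp, Sigma.ι_desc]
    exact (adj i).right_triangle_components X⟩

variable [Preadditive T] [HasZeroObject T] [HasShift T ℤ] [∀ n : ℤ, (shiftFunctor T n).Additive]
  [Pretriangulated T] [∀ i, Preadditive (D i)] [∀ i, HasZeroObject (D i)] [∀ i, HasShift (D i) ℤ]
  [∀ i (n : ℤ), (shiftFunctor (D i) n).Additive] [∀ i, Pretriangulated (D i)]

/-- Any `f : W ⟶ X` in a localising subcategory can be factored through a cone `W'` in the
subcategory so that `W ⟶ W'` kills everything that `f` kills after applying each `F i`. -/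
lemma exists_factor_killing_kernel {G : ∀ i, D i ⥤ T} {F : ∀ i, T ⥤ D i}
    (adj : ∀ i, G i ⊣ F i)
    [∀ i, (F i).CommShift ℤ] [∀ i, (F i).IsTriangulated]
    [∀ i, (G i).CommShift ℤ] [∀ i, (G i).IsTriangulated]
    {L : Set T} (hL : IsLocalisingSubcategory T L)
    (hGF : ∀ i, ∀ W ∈ L, (G i).obj ((F i).obj W) ∈ L)
    {X : T} (hX : ∀ i, (G i).obj ((F i).obj X) ∈ L) {W : T} (hW : W ∈ L) (f : W ⟶ X) :
    ∃ W' ∈ L, ∃ (g : W ⟶ W') (f' : W' ⟶ X), g ≫ f' = f ∧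
      ∀ i ⦃Y : D i⦄ (h : Y ⟶ (F i).obj W), h ≫ (F i).map f = 0 → h ≫ (F i).map g = 0 := by
  obtain ⟨K, k, d, hK⟩ := distinguished_cocone_triangle₁ f
  have hK' (i : I) : (G i).obj ((F i).obj K) ∈ L :=
    hL.mem_obj₁ _ ((G i).map_distinguished _ ((F i).map_distinguished _ hK)) (hGF i W hW) (hX i)
  let c : (∐ fun j => (G j).obj ((F j).obj K)) ⟶ K :=
    Sigma.desc fun j => (adj j).counit.app K
  obtain ⟨W', g, e, hW'⟩ := distinguished_cocone_triangle (c ≫ k)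
  have hkf : k ≫ f = 0 := comp_distTriang_mor_zero₁₂ _ hK
  have hckg : (c ≫ k) ≫ g = 0 := comp_distTriang_mor_zero₁₂ _ hW'
  have hckf : (c ≫ k) ≫ f = 0 := by rw [Category.assoc, hkf, comp_zero]
  obtain ⟨f', hf'⟩ := Triangle.yoneda_exact₂ _ hW' f hckf
  refine ⟨W', hL.2.2.2.1 _ hW' (hL.2.2.2.2.2 _ hK') hW, g, f', hf'.symm, fun i Y h hh => ?_⟩
  obtain ⟨h', rfl⟩ : ∃ h' : Y ⟶ (F i).obj K, h = h' ≫ (F i).map k :=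
    Triangle.coyoneda_exact₂ _ ((F i).map_distinguished _ hK) h hh
  obtain ⟨σ, hσ⟩ : ∃ σ, σ ≫ (F i).map c = 𝟙 _ := exists_section_map_desc_counit adj K i
  rw [← Category.comp_id h', ← hσ]
  simp only [Category.assoc]
  rw [← Functor.map_comp, ← Functor.map_comp, ← Category.assoc c, hckg, Functor.map_zero,
    comp_zero, comp_zero]

/-- If the functors `F i` jointly detect zero objects, then membership of `X` in a localising
subcategory stable under all `F i ⋙ G i` can be checked on the objects `G i (F i X)`. -/
lemma mem_of_forall_obj_obj_mem {G : ∀ i, D i ⥤ T} {F : ∀ i, T ⥤ D i}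
    (adj : ∀ i, G i ⊣ F i)
    [∀ i, (F i).CommShift ℤ] [∀ i, (F i).IsTriangulated]
    [∀ i, (G i).CommShift ℤ] [∀ i, (G i).IsTriangulated]
    [∀ i (ι : Type v), PreservesColimitsOfShape (Discrete ι) (F i)]
    (detect : ∀ X : T, (∀ i, IsZero ((F i).obj X)) → IsZero X)
    {L : Set T} (hL : IsLocalisingSubcategory T L)
    (hGF : ∀ i, ∀ W ∈ L, (G i).obj ((F i).obj W) ∈ L)
    {X : T} (hX : ∀ i, (G i).obj ((F i).obj X) ∈ L) : X ∈ L := by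
  have e : Discrete (ULift.{v} ℕ) ≌ Discrete ℕ := Discrete.equivalence Equiv.ulift
  have : HasColimitsOfShape (Discrete ℕ) T := hasColimitsOfShape_of_equivalence e
  have (i : I) : PreservesColimitsOfShape (Discrete ℕ) (F i) :=
    preservesColimitsOfShape_of_equiv e (F i)
  choose next hnext g f' hgf hker using
    fun w : Σ' W : T, PProd (W ∈ L) (W ⟶ X) =>
      exists_factor_killing_kernel adj hL hGF hX w.2.1 w.2.2
  let w : ℕ → Σ' W : T, PProd (W ∈ L) (W ⟶ X) := fun n =>
    Nat.rec ⟨∐ fun j => (G j).obj ((F j).obj X), hL.2.2.2.2.2 _ hX,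
      Sigma.desc fun j => (adj j).counit.app X⟩ (fun _ w => ⟨next w, hnext w, f' w⟩) n
  let A : ℕ → T := fun n => (w n).1
  let p : ∀ n, A n ⟶ X := fun n => (w n).2.2
  let a : ∀ n, A n ⟶ A (n + 1) := fun n => g (w n)
  have hap (n : ℕ) : a n ≫ p (n + 1) = p n := hgf (w n)
  let s : ∐ A ⟶ ∐ A := Sigma.desc fun n => a n ≫ Sigma.ι A (n + 1)
  obtain ⟨H, q, δ, hT⟩ := distinguished_cocone_triangle (𝟙 (∐ A) - s)
  have hA : (∐ A) ∈ L :=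
    hL.1 (Sigma.reindex Equiv.ulift.{v} A) (hL.2.2.2.2.2 _ fun n => (w n.down).2.1)
  have hH : H ∈ L := hL.2.2.2.1 _ hT hA hA
  have hsp : (𝟙 (∐ A) - s) ≫ Sigma.desc p = 0 := Sigma.hom_ext _ _ fun n => by
    simp [s, Preadditive.sub_comp, Preadditive.comp_sub, hap]
  obtain ⟨ψ, hψ⟩ : ∃ ψ : H ⟶ X, Sigma.desc p = q ≫ ψ :=
    Triangle.yoneda_exact₂ _ hT (Sigma.desc p) hsp
  have hιψ (n : ℕ) : Sigma.ι A n ≫ q ≫ ψ = p n := by rw [← hψ, Sigma.ι_desc]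
  obtain ⟨Z, b, d, hZ⟩ := distinguished_cocone_triangle ψ
  have hZ₀ : IsZero Z := detect Z fun i => by
    obtain ⟨σ₀, hσ₀⟩ := exists_section_map_desc_counit adj X i
    have : IsIso ((F i).map ψ) := by
      refine isIso_of_telescope (fun n => (F i).map (a n)) (fun n => (F i).map (p n))
        (fun n => by rw [← Functor.map_comp, hap]) (fun n => hker (w n) i) σ₀ hσ₀
        (fun n => (F i).map (Sigma.ι A n))
        (isColimitCofanMkObjOfIsColimit (F i) _ _ (coproductIsCoproduct A)) ((F i).map s)
        (fun n => by rw [← Functor.map_comp, ← Functor.map_comp, Sigma.ι_desc])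
        ((F i).map q) ((F i).map δ ≫ ((F i).commShiftIso (1 : ℤ)).hom.app _) ?_ _
        (fun n => by rw [← Functor.map_comp, ← Functor.map_comp, hιψ])
      rw [← (F i).map_id, ← (F i).map_sub]
      exact (F i).map_distinguished _ hT
    exact Triangle.isZero₃_of_isIso₁ _ ((F i).map_distinguished _ hZ) this
  have : IsIso ψ := (Triangle.isZero₃_iff_isIso₁ _ hZ).1 hZ₀
  exact hL.1 (asIso ψ) hH

end Detection

/-- detection of localising tensor ideals on a family of exact
coproduct-preserving strong symmetric monoidal functors into compactly generated
tensor-triangulated categories satisfying the projection formula, the retract property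
and the detection property. -/
theorem statement11 {T : Type u} [Category.{v} T] [Preadditive T] [HasCoproducts.{v} T]
    [HasZeroObject T] [HasShift T ℤ] [∀ n : ℤ, (shiftFunctor T n).Additive]
    [Pretriangulated T] [MonoidalCategory T] [SymmetricCategory T]
    -- the tensor product of `T` is exact and commutes with coproducts in each variable
    [∀ X : T, (tensorLeft X).CommShift ℤ] [∀ X : T, (tensorLeft X).IsTriangulated]
    [∀ X : T, (tensorRight X).CommShift ℤ] [∀ X : T, (tensorRight X).IsTriangulated]
    [∀ (X : T) (ι : Type v), PreservesColimitsOfShape (Discrete ι) (tensorLeft X)]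
    [∀ (X : T) (ι : Type v), PreservesColimitsOfShape (Discrete ι) (tensorRight X)]
    {I : Type v} (Ti : I → Type u₂) [∀ i, Category.{v} (Ti i)]
    [∀ i, Preadditive (Ti i)] [∀ i, HasCoproducts.{v} (Ti i)]
    [∀ i, HasZeroObject (Ti i)] [∀ i, HasShift (Ti i) ℤ]
    [∀ i (n : ℤ), (shiftFunctor (Ti i) n).Additive] [∀ i, Pretriangulated (Ti i)]
    [∀ i, MonoidalCategory (Ti i)] [∀ i, SymmetricCategory (Ti i)]
    [∀ i (X : Ti i), (tensorLeft X).CommShift ℤ] [∀ i (X : Ti i), (tensorLeft X).IsTriangulated]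
    [∀ i (X : Ti i), (tensorRight X).CommShift ℤ] [∀ i (X : Ti i), (tensorRight X).IsTriangulated]
    [∀ i (X : Ti i) (ι : Type v), PreservesColimitsOfShape (Discrete ι) (tensorLeft X)]
    [∀ i (X : Ti i) (ι : Type v), PreservesColimitsOfShape (Discrete ι) (tensorRight X)]
    -- each `Ti` is compactly generated by a set of compact objects
    (Gs : ∀ i, Set (Ti i)) (hGs : ∀ i, IsCompactlyGeneratedBy (Ti i) (Gs i))
    -- exact coproduct-preserving strong symmetric monoidal functors `F i : T ⥤ Ti i`
    (F : ∀ i, T ⥤ Ti i) [∀ i, (F i).CommShift ℤ] [∀ i, (F i).IsTriangulated]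
    [∀ i, (F i).Braided]
    [∀ i (ι : Type v), PreservesColimitsOfShape (Discrete ι) (F i)]
    -- with exact left adjoints `L i`
    (Lf : ∀ i, Ti i ⥤ T) [∀ i, (Lf i).CommShift ℤ] [∀ i, (Lf i).IsTriangulated]
    (adj : ∀ i, Lf i ⊣ F i)
    -- the projection formula
    (proj : ∀ i (X : T) (Y : Ti i),
      Nonempty ((Lf i).obj ((F i).obj X ⊗ Y) ≅ X ⊗ (Lf i).obj Y))
    -- the retract property
    (retr : ∀ i (Y : Ti i), ∃ (j : Y ⟶ (F i).obj ((Lf i).obj Y))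
      (r : (F i).obj ((Lf i).obj Y) ⟶ Y), j ≫ r = 𝟙 Y)
    -- the detection property
    (detect : ∀ X : T, IsZero X ↔ ∀ i, IsZero ((F i).obj X)) :
    ∀ X : T,
      (locTensorIdealGen T {X} =
        locTensorIdealGen T {∐ (fun i => (Lf i).obj ((F i).obj X))}) ∧
      (∀ L : Set T, IsLocalisingTensorIdeal T L →
        (X ∈ L ↔ ∀ i, (Lf i).obj ((F i).obj X) ∈ L)) := by
  have hLF (i : I) (X : T) : Nonempty ((Lf i).obj ((F i).obj X) ≅ X ⊗ (Lf i).obj (𝟙_ (Ti i))) :=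
    (proj i X (𝟙_ (Ti i))).map fun e => (Lf i).mapIso (ρ_ _).symm ≪≫ e
  have hstable {L : Set T} (hL : IsLocalisingTensorIdeal T L) (i : I) (W : T) (hW : W ∈ L) :
      (Lf i).obj ((F i).obj W) ∈ L :=
    (hLF i W).elim fun e => hL.1.1 e.symm (hL.2 hW _)
  have hiff (X : T) (L : Set T) (hL : IsLocalisingTensorIdeal T L) :
      X ∈ L ↔ ∀ i, (Lf i).obj ((F i).obj X) ∈ L :=
    ⟨fun hX i => hstable hL i X hX, mem_of_forall_obj_obj_mem adj (fun X => (detect X).2) hL.1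
      (hstable hL)⟩
  have hcoprod (X : T) (L : Set T) (hL : IsLocalisingTensorIdeal T L) :
      X ∈ L ↔ (∐ fun i => (Lf i).obj ((F i).obj X)) ∈ L := by
    classical
    refine (hiff X L hL).trans ⟨hL.1.2.2.2.2.2 _, fun h i => ?_⟩
    exact hL.1.2.2.2.2.1 (Sigma.ι (fun i => (Lf i).obj ((F i).obj X)) i) (Sigma.π _ i)
      (Sigma.ι_π_eq_id _ i) h
  refine fun X => ⟨?_, hiff X⟩
  unfold locTensorIdealGen
  congr 1
  ext L
  simp only [Set.mem_ofPred_eq, Set.singleton_subset_iff]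
  exact and_congr_right (hcoprod X L)
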